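/- For fixed data x, the WBIC of model M_N admits the decomposition WBIC = ∑_{i=1}^n log p(x_i | θ_0) − (1/2) log n + (n/2)(x̄ − θ_0)² + r_n(x), where the remainder r_n satisfies: for every θ_0 ∈ ℝ and every C > 0, sup over data x with |x̄ − θ_0| ≤ C/√n and (1/n)∑ x_i² ≤ C of |r_n(x)| tends to 0 as n → ∞. -/

import Mathlib

open MeasureTheory ProbabilityTheory Real

/-- Normal likelihood density `p(x | θ) = (2π)^{-1/2} exp(−(x−θ)²/2)`. -/
noncomputable def normalLik (x θ : ℝ) : ℝ :=
  (Real.sqrt (2 * Real.pi))⁻¹ * Real.exp (-(x - θ)^2 / 2)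

/-- WBIC of model `M_N` for data `x`:
`WBIC = E^{t_w}[∑ᵢ log p(xᵢ|θ)]` with `t_w = (log n)⁻¹`, the expectation being
under the tempered posterior `N(m_{t_w}, v_{t_w})`. -/
noncomputable def wbicN (n : ℕ) (m v : ℝ) (x : Fin n → ℝ) : ℝ :=
  let tw := (Real.log n)⁻¹
  let xbar := (∑ i, x i) / n
  let mt := (n * tw * xbar + m / v) / (n * tw + 1 / v)
  let vt := (n * tw + 1 / v)⁻¹
  ∫ θ, (∑ i, Real.log (normalLik (x i) θ)) ∂(gaussianReal mt vt.toNNReal)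

lemma integrable_sub_sq_gaussianReal (a μ : ℝ) (v : NNReal) :
    Integrable (fun θ => (a - θ) ^ 2) (gaussianReal μ v) := by
  have h : MemLp (fun θ : ℝ => a - θ) 2 (gaussianReal μ v) :=
    (memLp_const a).sub (memLp_id_gaussianReal 2)
  exact h.integrable_sq

lemma integral_sub_sq_gaussianReal (a μ : ℝ) (v : NNReal) :
    ∫ θ, (a - θ) ^ 2 ∂(gaussianReal μ v) = (a - μ) ^ 2 + v := by
  have hid : Integrable (fun θ : ℝ => θ) (gaussianReal μ v) :=
    (memLp_id_gaussianReal 1).integrable le_rfl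
  have hvar : ∫ θ, (μ - θ) ^ 2 ∂(gaussianReal μ v) = v := by
    rw [← variance_fun_id_gaussianReal (μ := μ), variance_eq_integral (by fun_prop),
      integral_id_gaussianReal]
    congr with θ
    ring
  have hmean : ∫ θ, (μ - θ) ∂(gaussianReal μ v) = 0 := by
    rw [integral_sub (integrable_const _) hid, integral_id_gaussianReal]
    simp
  calc ∫ θ, (a - θ) ^ 2 ∂(gaussianReal μ v)
      = ∫ θ, ((a - μ) ^ 2 + 2 * (a - μ) * (μ - θ) + (μ - θ) ^ 2) ∂(gaussianReal μ v) := by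
        congr with θ
        ring
    _ = (a - μ) ^ 2 + v := by
        have hlin : Integrable (fun θ => 2 * (a - μ) * (μ - θ)) (gaussianReal μ v) :=
          ((integrable_const _).sub hid).const_mul _
        have hadd : Integrable (fun θ => (a - μ) ^ 2 + 2 * (a - μ) * (μ - θ))
            (gaussianReal μ v) := (integrable_const _).add hlin
        rw [integral_add hadd (integrable_sub_sq_gaussianReal _ _ _),
          integral_add (integrable_const _) hlin, integral_const_mul, hmean, hvar]
        simp

lemma log_normalLik (x θ : ℝ) :
    Real.log (normalLik x θ) = -Real.log (Real.sqrt (2 * Real.pi)) - (x - θ) ^ 2 / 2 := by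
  have h : Real.sqrt (2 * Real.pi) ≠ 0 := by positivity
  rw [normalLik, Real.log_mul (inv_ne_zero h) (Real.exp_ne_zero _), Real.log_inv, Real.log_exp]
  ring

/-- The expected log-likelihood under a normal law of the parameter. -/
lemma integral_sum_log_normalLik_gaussianReal (n : ℕ) (x : Fin n → ℝ) (μ : ℝ) (v : NNReal) :
    ∫ θ, (∑ i, Real.log (normalLik (x i) θ)) ∂(gaussianReal μ v) =
      (∑ i, Real.log (normalLik (x i) μ)) - n * v / 2 := by
  have hint (i : Fin n) : Integrable (fun θ => (x i - θ) ^ 2 / 2) (gaussianReal μ v) :=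
    (integrable_sub_sq_gaussianReal _ _ _).div_const 2
  have hlog (i : Fin n) : Integrable (fun θ => Real.log (normalLik (x i) θ)) (gaussianReal μ v) ∧
      ∫ θ, Real.log (normalLik (x i) θ) ∂(gaussianReal μ v) =
        Real.log (normalLik (x i) μ) - v / 2 := by
    simp only [log_normalLik]
    refine ⟨(integrable_const _).sub (hint i), ?_⟩
    rw [integral_sub (integrable_const _) (hint i), integral_div, integral_sub_sq_gaussianReal]
    simp
    ring
  rw [integral_finsetSum _ fun i _ => (hlog i).1]
  simp only [(hlog _).2, Finset.sum_sub_distrib, Finset.sum_const, Finset.card_univ,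
    Fintype.card_fin, nsmul_eq_mul]
  ring

/-- Comparison of the log-likelihood at two parameters through the sample mean. -/
lemma sum_log_normalLik_sub (n : ℕ) (hn : n ≠ 0) (x : Fin n → ℝ) (μ θ : ℝ) :
    (∑ i, Real.log (normalLik (x i) μ)) - ∑ i, Real.log (normalLik (x i) θ) =
      n / 2 * (((∑ i, x i) / n - θ) ^ 2 - ((∑ i, x i) / n - μ) ^ 2) := by
  have hn' : (n : ℝ) ≠ 0 := by exact_mod_cast hn
  rw [← Finset.sum_sub_distrib]
  have h (i : Fin n) : Real.log (normalLik (x i) μ) - Real.log (normalLik (x i) θ) =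
      (μ - θ) * x i + (θ ^ 2 - μ ^ 2) / 2 := by
    rw [log_normalLik, log_normalLik]
    ring
  simp_rw [h]
  rw [Finset.sum_add_distrib, ← Finset.mul_sum]
  simp
  field_simp
  ring

/-- The exact remainder of the decomposition of the WBIC. -/
lemma wbicN_sub_eq (n : ℕ) (hn : 2 ≤ n) (m v : ℝ) (hv : 0 < v) (θ₀ : ℝ) (x : Fin n → ℝ) :
    wbicN n m v x -
        ((∑ i, Real.log (normalLik (x i) θ₀)) - (1 / 2) * Real.log n +
          (n / 2) * ((∑ i, x i) / n - θ₀) ^ 2) =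
      (Real.log n ^ 2 / (n * v + Real.log n) -
        n * (((∑ i, x i) / n - m) * Real.log n / (n * v + Real.log n)) ^ 2) / 2 := by
  have hn' : (0 : ℝ) < n := by positivity
  have hL : 0 < Real.log n := Real.log_pos (by exact_mod_cast hn)
  have hvar : 0 ≤ (n * (Real.log n)⁻¹ + 1 / v)⁻¹ := by positivity
  have hbase := sum_log_normalLik_sub n (by lia) x
    ((n * (Real.log n)⁻¹ * ((∑ i, x i) / n) + m / v) / (n * (Real.log n)⁻¹ + 1 / v)) θ₀
  have hmean : (∑ i, x i) / n -
      (n * (Real.log n)⁻¹ * ((∑ i, x i) / n) + m / v) / (n * (Real.log n)⁻¹ + 1 / v) =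
      ((∑ i, x i) / n - m) * Real.log n / (n * v + Real.log n) := by
    field_simp
    ring
  have hvt : n * (n * (Real.log n)⁻¹ + 1 / v)⁻¹ =
      Real.log n - Real.log n ^ 2 / (n * v + Real.log n) := by
    field_simp
    ring
  rw [hmean] at hbase
  simp only [wbicN]
  rw [integral_sum_log_normalLik_gaussianReal, Real.coe_toNNReal _ hvar, hvt]
  linarith

lemma abs_wbic_remainder_le {n L v d K : ℝ} (hn : 0 < n) (hL : 0 < L) (hv : 0 < v)
    (hd : |d| ≤ K) :
    |(L ^ 2 / (n * v + L) - n * (d * L / (n * v + L)) ^ 2) / 2| ≤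
      (1 / v + K ^ 2 / v ^ 2) * (L ^ 2 / n) := by
  have h₁ : L ^ 2 / (n * v + L) ≤ 1 / v * (L ^ 2 / n) := by
    rw [div_mul_div_comm, one_mul, mul_comm v n]
    gcongr
    linarith
  have h₂ : n * (d * L / (n * v + L)) ^ 2 ≤ K ^ 2 / v ^ 2 * (L ^ 2 / n) := by
    have hdK : d ^ 2 ≤ K ^ 2 := sq_le_sq' (abs_le.mp hd).1 (abs_le.mp hd).2
    calc n * (d * L / (n * v + L)) ^ 2 = n * (d ^ 2 * L ^ 2 / (n * v + L) ^ 2) := by rw [div_pow, mul_pow]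
      _ ≤ n * (K ^ 2 * L ^ 2 / (n * v) ^ 2) := by
        gcongr
        linarith
      _ = K ^ 2 / v ^ 2 * (L ^ 2 / n) := by field_simp
  have h₃ : 0 ≤ L ^ 2 / (n * v + L) := by positivity
  have h₄ : 0 ≤ n * (d * L / (n * v + L)) ^ 2 := by positivity
  rw [abs_le]
  constructor <;> linarith

lemma tendsto_log_sq_div_natCast_atTop :
    Filter.Tendsto (fun n : ℕ => Real.log n ^ 2 / n) Filter.atTop (nhds 0) :=
  (isLittleO_pow_log_id_atTop (n := 2)).tendsto_div_nhds_zero.comp tendsto_natCast_atTop_atTop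

/-- for fixed data, WBIC of model `M_N` decomposes as
`WBIC = ∑ᵢ log p(xᵢ|θ₀) − (1/2)log n + (n/2)(x̄−θ₀)² + rₙ(x)`, where for every
`θ₀` and `C > 0` the supremum of `|rₙ(x)|` over data with `|x̄−θ₀| ≤ C/√n` and
`(1/n)∑ xᵢ² ≤ C` tends to `0` as `n → ∞`. -/
theorem normal_wbic_decomposition
    (m v : ℝ) (hv : 0 < v) (θ₀ : ℝ) (C : ℝ) (hC : 0 < C) :
    ∀ δ : ℝ, 0 < δ → ∃ N : ℕ, ∀ n : ℕ, N ≤ n → ∀ x : Fin n → ℝ,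
      |(∑ i, x i) / n - θ₀| ≤ C / Real.sqrt n →
      (1 / n) * ∑ i, (x i)^2 ≤ C →
      |wbicN n m v x -
          ((∑ i, Real.log (normalLik (x i) θ₀)) - (1 / 2) * Real.log n +
            (n / 2) * ((∑ i, x i) / n - θ₀)^2)| ≤ δ := by
  intro δ hδ
  have hlim := tendsto_log_sq_div_natCast_atTop.const_mul
    (1 / v + (C + |θ₀ - m|) ^ 2 / v ^ 2)
  rw [mul_zero] at hlim
  obtain ⟨N, hN⟩ := Filter.eventually_atTop.mp (hlim.eventually_le_const hδ)
  refine ⟨max N 2, fun n hn x hx _ => ?_⟩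
  have hn₂ : 2 ≤ n := le_of_max_le_right hn
  have hone : (1 : ℝ) ≤ n := by exact_mod_cast (by lia : 1 ≤ n)
  have hxm : |(∑ i, x i) / n - m| ≤ C + |θ₀ - m| :=
    calc |(∑ i, x i) / n - m| ≤ |(∑ i, x i) / n - θ₀| + |θ₀ - m| := abs_sub_le _ _ _
      _ ≤ C + |θ₀ - m| := by
        gcongr
        exact hx.trans (div_le_self hC.le (Real.one_le_sqrt.mpr hone))
  rw [wbicN_sub_eq n hn₂ m v hv]
  exact (abs_wbic_remainder_le (by linarith) (Real.log_pos (by exact_mod_cast hn₂)) hv hxm).trans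
    (hN n (le_of_max_le_left hn))
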